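/- arXiv:2404.08308 — 3 statements merged into one kernel-verified Lean document; each statement's English description precedes it below -/
import Mathlib

section
/- Let σ : [0,1]² → [0,1] satisfy condition (⋆). Then for any two 1-bounded pseudometric spaces (X,d_X) and (Y,d_Y), the function D on (X×Y)×(X×Y) defined by D((x,y),(x',y')) := σ(d_X(x,x'), d_Y(y,y')) is a 1-bounded pseudometric on X×Y (that is, D((x,y),(x,y)) = 0, D is symmetric, and D satisfies the triangle inequality). Moreover, if f : X → X' and g : Y → Y' are nonexpansive maps between 1-bounded pseudometric spaces, then the map f×g : X×Y → X'×Y' is nonexpansive with respect to the corresponding σ-combined pseudometrics. -/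
open Set

/-- `d` is a pseudometric: `d x x = 0`, symmetry, and the triangle inequality. -/
def IsPseudometric {X : Type*} (d : X → X → ℝ) : Prop :=
  (∀ x, d x x = 0) ∧ (∀ x y, d x y = d y x) ∧ (∀ x y z, d x z ≤ d x y + d y z)

/-- `d` is 1-bounded: all values are at most `1`. -/
def IsBounded1 {X : Type*} (d : X → X → ℝ) : Prop := ∀ x y, d x y ≤ 1

theorem IsPseudometric.nonneg {X : Type*} {d : X → X → ℝ} (h : IsPseudometric d) (x y : X) :
    0 ≤ d x y := by
  obtain ⟨h0, hs, ht⟩ := h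
  linarith [h0 x, hs x y, ht x y x]

theorem IsPseudometric.mem_Icc {X : Type*} {d : X → X → ℝ} (h : IsPseudometric d)
    (hb : IsBounded1 d) (x y : X) : d x y ∈ Icc (0:ℝ) 1 :=
  ⟨h.nonneg x y, hb x y⟩

theorem IsPseudometric.abs_sub_le {X : Type*} {d : X → X → ℝ} (h : IsPseudometric d)
    (x y z : X) : |d x z - d x y| ≤ d y z := by
  obtain ⟨-, hs, ht⟩ := h
  rw [abs_le]
  constructor <;> linarith [ht x y z, ht x z y, hs y z]

theorem statement_0 (σ : ℝ → ℝ → ℝ)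
    (hσmem : ∀ a ∈ Icc (0:ℝ) 1, ∀ b ∈ Icc (0:ℝ) 1, σ a b ∈ Icc (0:ℝ) 1)
    (hmono : ∀ a ∈ Icc (0:ℝ) 1, ∀ b ∈ Icc (0:ℝ) 1, ∀ c ∈ Icc (0:ℝ) 1, ∀ d ∈ Icc (0:ℝ) 1,
      a ≤ c → b ≤ d → σ a b ≤ σ c d)
    (hzero : σ 0 0 = 0)
    (hstar : ∀ a ∈ Icc (0:ℝ) 1, ∀ b ∈ Icc (0:ℝ) 1, ∀ c ∈ Icc (0:ℝ) 1, ∀ d ∈ Icc (0:ℝ) 1,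
      σ a b - σ c d ≤ σ |a - c| |b - d|) :
    -- the σ-combined distance is a 1-bounded pseudometric
    (∀ (X Y : Type) (dX : X → X → ℝ) (dY : Y → Y → ℝ),
        IsPseudometric dX → IsBounded1 dX → IsPseudometric dY → IsBounded1 dY →
        IsPseudometric (fun p q : X × Y => σ (dX p.1 q.1) (dY p.2 q.2)) ∧
          IsBounded1 (fun p q : X × Y => σ (dX p.1 q.1) (dY p.2 q.2)))
    ∧
    -- products of nonexpansive maps are nonexpansive for the σ-combined pseudometrics
    (∀ (X X' Y Y' : Type) (dX : X → X → ℝ) (dX' : X' → X' → ℝ)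
        (dY : Y → Y → ℝ) (dY' : Y' → Y' → ℝ) (f : X → X') (g : Y → Y'),
        IsPseudometric dX → IsBounded1 dX → IsPseudometric dX' → IsBounded1 dX' →
        IsPseudometric dY → IsBounded1 dY → IsPseudometric dY' → IsBounded1 dY' →
        (∀ s t, dX' (f s) (f t) ≤ dX s t) → (∀ s t, dY' (g s) (g t) ≤ dY s t) →
        ∀ p q : X × Y,
          σ (dX' (f p.1) (f q.1)) (dY' (g p.2) (g q.2)) ≤ σ (dX p.1 q.1) (dY p.2 q.2)) := by
  refine ⟨fun X Y dX dY hX bX hY bY => ⟨⟨fun p => ?_, fun p q => ?_, fun p q r => ?_⟩,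
    fun p q => ?_⟩, ?_⟩
  · simp only [hX.1, hY.1, hzero]
  · simp only [hX.2.1 p.1, hY.2.1 p.2]
  · have mX := hX.mem_Icc bX
    have mY := hY.mem_Icc bY
    have aX := hX.abs_sub_le p.1 q.1 r.1
    have aY := hY.abs_sub_le p.2 q.2 r.2
    have hsub := hstar _ (mX p.1 r.1) _ (mY p.2 r.2) _ (mX p.1 q.1) _ (mY p.2 q.2)
    have hle := hmono _ ⟨abs_nonneg _, aX.trans (bX _ _)⟩ _ ⟨abs_nonneg _, aY.trans (bY _ _)⟩
      _ (mX q.1 r.1) _ (mY q.2 r.2) aX aY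
    exact sub_le_iff_le_add'.mp (hsub.trans hle)
  · exact (hσmem _ (hX.mem_Icc bX _ _) _ (hY.mem_Icc bY _ _)).2
  · intro X X' Y Y' dX dX' dY dY' f g hX bX hX' bX' hY bY hY' bY' hf hg p q
    exact hmono _ (hX'.mem_Icc bX' _ _) _ (hY'.mem_Icc bY' _ _) _ (hX.mem_Icc bX _ _)
      _ (hY.mem_Icc bY _ _) (hf _ _) (hg _ _)
end

section
/- Let σ : [0,1]² → [0,1] be a function such that: (i) for every pair of 1-bounded pseudometric spaces (X,d_X), (Y,d_Y), the function D((x,y),(x',y')) := σ(d_X(x,x'), d_Y(y,y')) is a pseudometric on X×Y, and (ii) for all nonexpansive maps f : (X,d_X) → (X',d_{X'}) and g : (Y,d_Y) → (Y',d_{Y'}) between 1-bounded pseudometric spaces, f×g is nonexpansive with respect to the corresponding σ-combined pseudometrics. Then σ satisfies condition (⋆): σ is monotone, σ(0,0) = 0, and σ(a,b) − σ(c,d) ≤ σ(|a−c|, |b−d|) for all a,b,c,d ∈ [0,1]. -/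
open Set

theorem isPseudometric_mul_abs_sub {r : ℝ} (hr : 0 ≤ r) :
    IsPseudometric (fun s t : Icc (0:ℝ) 1 => r * |(s:ℝ) - t|) := by
  refine ⟨fun x => by simp, fun x y => by simp only [abs_sub_comm], fun x y z => ?_⟩
  rw [← mul_add]
  exact mul_le_mul_of_nonneg_left (abs_sub_le _ _ _) hr

theorem isBounded1_mul_abs_sub {r : ℝ} (hr : r ≤ 1) :
    IsBounded1 (fun s t : Icc (0:ℝ) 1 => r * |(s:ℝ) - t|) := by
  intro s t
  have h : |(s:ℝ) - t| ≤ 1 :=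
    abs_le.2 ⟨by linarith [s.2.1, t.2.2], by linarith [s.2.2, t.2.1]⟩
  exact (mul_le_mul_of_nonneg_right hr (abs_nonneg _)).trans (by rwa [one_mul])

theorem statement_1 (σ : ℝ → ℝ → ℝ)
    (hσmem : ∀ a ∈ Icc (0:ℝ) 1, ∀ b ∈ Icc (0:ℝ) 1, σ a b ∈ Icc (0:ℝ) 1)
    -- (i) the σ-combined distance is always a pseudometric
    (hi : ∀ (X Y : Type) (dX : X → X → ℝ) (dY : Y → Y → ℝ),
        IsPseudometric dX → IsBounded1 dX → IsPseudometric dY → IsBounded1 dY →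
        IsPseudometric (fun p q : X × Y => σ (dX p.1 q.1) (dY p.2 q.2)))
    -- (ii) products of nonexpansive maps are nonexpansive for the σ-combined pseudometrics
    (hii : ∀ (X X' Y Y' : Type) (dX : X → X → ℝ) (dX' : X' → X' → ℝ)
        (dY : Y → Y → ℝ) (dY' : Y' → Y' → ℝ) (f : X → X') (g : Y → Y'),
        IsPseudometric dX → IsBounded1 dX → IsPseudometric dX' → IsBounded1 dX' →
        IsPseudometric dY → IsBounded1 dY → IsPseudometric dY' → IsBounded1 dY' →
        (∀ s t, dX' (f s) (f t) ≤ dX s t) → (∀ s t, dY' (g s) (g t) ≤ dY s t) →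
        ∀ p q : X × Y,
          σ (dX' (f p.1) (f q.1)) (dY' (g p.2) (g q.2)) ≤ σ (dX p.1 q.1) (dY p.2 q.2)) :
    -- then σ satisfies condition (⋆)
    (∀ a ∈ Icc (0:ℝ) 1, ∀ b ∈ Icc (0:ℝ) 1, ∀ c ∈ Icc (0:ℝ) 1, ∀ d ∈ Icc (0:ℝ) 1,
      a ≤ c → b ≤ d → σ a b ≤ σ c d)
    ∧ σ 0 0 = 0
    ∧ (∀ a ∈ Icc (0:ℝ) 1, ∀ b ∈ Icc (0:ℝ) 1, ∀ c ∈ Icc (0:ℝ) 1, ∀ d ∈ Icc (0:ℝ) 1,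
      σ a b - σ c d ≤ σ |a - c| |b - d|) := by
  refine ⟨?_, ?_, ?_⟩
  · intro a ha b hb c hc d hd hac hbd
    have h := hii (Icc (0:ℝ) 1) (Icc (0:ℝ) 1) (Icc (0:ℝ) 1) (Icc (0:ℝ) 1) _ _ _ _ id id
      (isPseudometric_mul_abs_sub hc.1) (isBounded1_mul_abs_sub hc.2)
      (isPseudometric_mul_abs_sub ha.1) (isBounded1_mul_abs_sub ha.2)
      (isPseudometric_mul_abs_sub hd.1) (isBounded1_mul_abs_sub hd.2)
      (isPseudometric_mul_abs_sub hb.1) (isBounded1_mul_abs_sub hb.2)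
      (fun _ _ => mul_le_mul_of_nonneg_right hac (abs_nonneg _))
      (fun _ _ => mul_le_mul_of_nonneg_right hbd (abs_nonneg _)) (0, 0) (1, 1)
    simpa using h
  · have h := (hi (Icc (0:ℝ) 1) (Icc (0:ℝ) 1) _ _
      (isPseudometric_mul_abs_sub zero_le_one) (isBounded1_mul_abs_sub le_rfl)
      (isPseudometric_mul_abs_sub zero_le_one) (isBounded1_mul_abs_sub le_rfl)).1 (0, 0)
    simpa using h
  · intro a ha b hb c hc d hd
    have h := (hi (Icc (0:ℝ) 1) (Icc (0:ℝ) 1) _ _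
      (isPseudometric_mul_abs_sub zero_le_one) (isBounded1_mul_abs_sub le_rfl)
      (isPseudometric_mul_abs_sub zero_le_one) (isBounded1_mul_abs_sub le_rfl)).2.2
      (⟨a, ha⟩, ⟨b, hb⟩) (⟨c, hc⟩, ⟨d, hd⟩) (0, 0)
    simp only [one_mul, Icc.coe_zero, sub_zero, abs_of_nonneg ha.1, abs_of_nonneg hb.1,
      abs_of_nonneg hc.1, abs_of_nonneg hd.1] at h
    linarith
end

section
/- Let d₁ be a 1-bounded Lawvere metric on X and d₂ a 1-bounded Lawvere metric on Y. Then for all x,x' ∈ X and y,y' ∈ Y, the supremum, over all functions k₁ : X → [0,1] with max(0, k₁(t) − k₁(s)) ≤ d₁(s,t) for all s,t ∈ X and all functions k₂ : Y → [0,1] with max(0, k₂(t) − k₂(s)) ≤ d₂(s,t) for all s,t ∈ Y, of max(0, min(k₁(x'), k₂(y')) − min(k₁(x), k₂(y))), equals max(d₁(x,x'), d₂(y,y')). -/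
open Set

/-- `d` is a 1-bounded Lawvere metric: `d x x = 0`, triangle inequality, values in `[0,1]`
(no symmetry required). -/
def IsLawvere1 {X : Type*} (d : X → X → ℝ) : Prop :=
  (∀ x, d x x = 0) ∧ (∀ x y z, d x z ≤ d x y + d y z) ∧ (∀ x y, d x y ∈ Icc (0:ℝ) 1)

/-- The distance from a fixed point is nonexpansive from `d` to the asymmetric distance. -/
lemma IsLawvere1.max_sub_le {X : Type*} {d : X → X → ℝ} (hd : IsLawvere1 d) (x s t : X) :
    max 0 (d x t - d x s) ≤ d s t :=
  max_le (hd.2.2 s t).1 (by linarith [hd.2.1 x s t])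

theorem statement_9 {X Y : Type*} (d₁ : X → X → ℝ) (d₂ : Y → Y → ℝ)
    (hd₁ : IsLawvere1 d₁) (hd₂ : IsLawvere1 d₂)
    (x x' : X) (y y' : Y) :
    sSup {v : ℝ | ∃ k₁ : X → ℝ, ∃ k₂ : Y → ℝ,
        (∀ t, k₁ t ∈ Icc (0:ℝ) 1) ∧ (∀ s t, max 0 (k₁ t - k₁ s) ≤ d₁ s t) ∧
        (∀ t, k₂ t ∈ Icc (0:ℝ) 1) ∧ (∀ s t, max 0 (k₂ t - k₂ s) ≤ d₂ s t) ∧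
        v = max 0 (min (k₁ x') (k₂ y') - min (k₁ x) (k₂ y))} =
      max (d₁ x x') (d₂ y y') := by
  refine IsGreatest.csSup_eq ⟨?_, ?_⟩
  · rcases le_total (d₂ y y') (d₁ x x') with h | h
    · refine ⟨d₁ x, fun _ => 1, hd₁.2.2 x, hd₁.max_sub_le x, by simp, fun s t => ?_, ?_⟩
      · simpa using (hd₂.2.2 s t).1
      · obtain ⟨h0, h1⟩ := hd₁.2.2 x x'
        simp [hd₁.1 x, h, h0, h1]
    · refine ⟨fun _ => 1, d₂ y, by simp, fun s t => ?_, hd₂.2.2 y, hd₂.max_sub_le y, ?_⟩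
      · simpa using (hd₁.2.2 s t).1
      · obtain ⟨h0, h1⟩ := hd₂.2.2 y y'
        simp [hd₂.1 y, h, h0, h1]
  · rintro v ⟨k₁, k₂, -, h₁, -, h₂, rfl⟩
    refine max_le (le_max_of_le_left (hd₁.2.2 x x').1) ?_
    have hk₁ := (le_max_right _ _).trans (h₁ x x')
    have hk₂ := (le_max_right _ _).trans (h₂ y y')
    rcases min_choice (k₁ x) (k₂ y) with h | h <;> rw [h]
    · exact le_max_of_le_left (by linarith [min_le_left (k₁ x') (k₂ y')])
    · exact le_max_of_le_right (by linarith [min_le_right (k₁ x') (k₂ y')])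
end
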